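/- Every three-dimensional real tensor admits an exact Tensor Train decomposition with ranks equal to the ranks of its unfoldings: for any f : Fin n₁ → Fin n₂ → Fin n₃ → ℝ, let r₁ be the rank of the matrix M₁ ∈ Matrix (Fin n₁) (Fin n₂ × Fin n₃) given by M₁(i₁, (i₂,i₃)) = f(i₁,i₂,i₃), and let r₂ be the rank of M₂ ∈ Matrix (Fin n₁ × Fin n₂) (Fin n₃) given by M₂((i₁,i₂), i₃) = f(i₁,i₂,i₃). Then there exist factors f¹ : Fin n₁ → Fin r₁ → ℝ, f² : Fin r₁ → Fin n₂ → Fin r₂ → ℝ, f³ : Fin r₂ → Fin n₃ → ℝ such that f(i₁,i₂,i₃) = Σ_{α₁ ∈ Fin r₁} Σ_{α₂ ∈ Fin r₂} f¹(i₁,α₁) · f²(α₁,i₂,α₂) · f³(α₂,i₃) for all i₁,i₂,i₃. -/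

import Mathlib

open Matrix in
/-- The projection onto the column space of a matrix factors through its rank. -/
theorem Matrix.exists_mul_mul_eq_self_of_rank {K m n : Type*} [Field K] [Fintype m] [Fintype n]
    (A : Matrix m n K) :
    ∃ (U : Matrix m (Fin A.rank) K) (L : Matrix (Fin A.rank) m K), U * L * A = A := by
  classical
  obtain ⟨g, hg⟩ := A.mulVecLin.range.subtype.exists_leftInverse_of_injective
    (LinearMap.ker_eq_bot.2 A.mulVecLin.range.injective_subtype)
  let e : A.mulVecLin.range ≃ₗ[K] (Fin A.rank → K) :=
    (Module.finBasis K A.mulVecLin.range).equivFun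
  refine ⟨LinearMap.toMatrix' (A.mulVecLin.range.subtype ∘ₗ e.symm.toLinearMap),
    LinearMap.toMatrix' (e.toLinearMap ∘ₗ g), ?_⟩
  apply Matrix.mulVec_injective
  funext v
  have h := LinearMap.congr_fun hg ⟨A *ᵥ v, v, rfl⟩
  simp only [LinearMap.comp_apply, Submodule.subtype_apply, LinearMap.id_apply] at h
  rw [← Matrix.mulVec_mulVec, ← Matrix.mulVec_mulVec, LinearMap.toMatrix'_mulVec,
    LinearMap.toMatrix'_mulVec]
  simp [h]

/-- Every 3D real tensor admits an exact Tensor Train decomposition whose TT ranks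
equal the ranks of the corresponding unfoldings. -/
theorem tensor_train_decomposition_3d
    {n₁ n₂ n₃ : ℕ} (f : Fin n₁ → Fin n₂ → Fin n₃ → ℝ)
    (r₁ r₂ : ℕ)
    (hr₁ : r₁ = (Matrix.of fun (i₁ : Fin n₁) (p : Fin n₂ × Fin n₃) => f i₁ p.1 p.2).rank)
    (hr₂ : r₂ = (Matrix.of fun (p : Fin n₁ × Fin n₂) (i₃ : Fin n₃) => f p.1 p.2 i₃).rank) :
    ∃ (f₁ : Fin n₁ → Fin r₁ → ℝ) (f₂ : Fin r₁ → Fin n₂ → Fin r₂ → ℝ)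
      (f₃ : Fin r₂ → Fin n₃ → ℝ),
      ∀ i₁ i₂ i₃, f i₁ i₂ i₃ =
        ∑ α₁ : Fin r₁, ∑ α₂ : Fin r₂, f₁ i₁ α₁ * f₂ α₁ i₂ α₂ * f₃ α₂ i₃ := by
  subst hr₁ hr₂
  obtain ⟨U, L, hUL⟩ := Matrix.exists_mul_mul_eq_self_of_rank
    (Matrix.of fun (i₁ : Fin n₁) (p : Fin n₂ × Fin n₃) => f i₁ p.1 p.2)
  have hr := Matrix.rank_transpose
    (Matrix.of fun (p : Fin n₁ × Fin n₂) (i₃ : Fin n₃) => f p.1 p.2 i₃)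
  have hVR := Matrix.exists_mul_mul_eq_self_of_rank
    (Matrix.of fun (p : Fin n₁ × Fin n₂) (i₃ : Fin n₃) => f p.1 p.2 i₃).transpose
  rw [hr] at hVR
  obtain ⟨V, R, hVR⟩ := hVR
  refine ⟨U, fun a i₂ b => ∑ j, ∑ k, L a j * f j i₂ k * R b k, fun b i₃ => V i₃ b,
    fun i₁ i₂ i₃ => ?_⟩
  have h₁ : f i₁ i₂ i₃ = ∑ j, (∑ a, U i₁ a * L a j) * f j i₂ i₃ := by
    simpa [Matrix.mul_apply] using (congrFun (congrFun hUL i₁) (i₂, i₃)).symm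
  have h₂ (j) : f j i₂ i₃ = ∑ k, (∑ b, V i₃ b * R b k) * f j i₂ k := by
    simpa [Matrix.mul_apply] using (congrFun (congrFun hVR i₃) (j, i₂)).symm
  calc
    f i₁ i₂ i₃ = ∑ j, ∑ a, ∑ k, ∑ b, U i₁ a * (L a j * f j i₂ k * R b k) * V i₃ b := by
      rw [h₁]
      refine Finset.sum_congr rfl fun j _ => ?_
      rw [h₂ j, Finset.sum_mul]
      simp only [Finset.mul_sum, Finset.sum_mul]
      refine Finset.sum_congr rfl fun a _ => Finset.sum_congr rfl fun k _ =>
        Finset.sum_congr rfl fun b _ => ?_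
      ring
    _ = ∑ a, ∑ b, ∑ j, ∑ k, U i₁ a * (L a j * f j i₂ k * R b k) * V i₃ b := by
      rw [Finset.sum_comm]
      refine Finset.sum_congr rfl fun a _ => ?_
      rw [Finset.sum_comm (s := Finset.univ (α := Fin (Matrix.rank _)))]
      exact Finset.sum_congr rfl fun j _ => Finset.sum_comm
    _ = _ := by simp only [Finset.mul_sum, Finset.sum_mul]
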